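/- arXiv:2010.05905 — 6 statements merged into one kernel-verified Lean document; each statement's English description precedes it below -/
import Mathlib

section
/- For every t > 0, lim_{R → ∞} ∫_{[0,t]²} γ₀(r − v) ( ∫_ℝ ℓ_R(ξ) φ(ξ) exp(−(r+v)ξ²/2) dξ ) dr dv = 0. (This expresses the asymptotic negligibility, after normalization by 2R, of the variance of the first Wiener chaos of the spatial average of the parabolic Anderson model.) -/
open MeasureTheory Real Filter

/-- The Fejér-type kernel is dominated by a rescaled Cauchy density. -/
lemma sin_sq_div_le_cauchy {R : ℝ} (hR : 0 < R) (ξ : ℝ) :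
    sin (R * ξ) ^ 2 / (π * R * ξ ^ 2) ≤ 2 * R / π * (1 + (R * ξ) ^ 2)⁻¹ := by
  rcases eq_or_ne ξ 0 with rfl | hξ
  · simp only [mul_zero, sin_zero]
    simp only [ne_eq, OfNat.ofNat_ne_zero, not_false_eq_true, zero_pow, mul_zero, div_zero]
    positivity
  have h1 : sin (R * ξ) ^ 2 ≤ 1 := sin_sq_le_one _
  have h2 : sin (R * ξ) ^ 2 ≤ (R * ξ) ^ 2 := sq_le_sq.mpr abs_sin_le_abs
  have hx : 0 < ξ ^ 2 := by positivity
  have key : sin (R * ξ) ^ 2 * (1 + (R * ξ) ^ 2) ≤ 2 * (R * ξ) ^ 2 := by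
    nlinarith [sq_nonneg (R * ξ)]
  rw [div_le_iff₀ (by positivity), ← mul_le_mul_iff_left₀ (show 0 < 1 + (R * ξ) ^ 2 by positivity)]
  calc _ ≤ 2 * (R * ξ) ^ 2 := key
    _ = _ := by
      field_simp

lemma lintegral_sin_sq_div_le {R : ℝ} (hR : 0 < R) :
    ∫⁻ ξ : ℝ, ENNReal.ofReal (sin (R * ξ) ^ 2 / (π * R * ξ ^ 2)) ≤ 2 := by
  have hint : Integrable fun ξ : ℝ => 2 * R / π * (1 + (R * ξ) ^ 2)⁻¹ :=
    (integrable_inv_one_add_sq.comp_mul_left' hR.ne').const_mul _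
  calc _ ≤ ∫⁻ ξ : ℝ, ENNReal.ofReal (2 * R / π * (1 + (R * ξ) ^ 2)⁻¹) :=
        lintegral_mono fun ξ => ENNReal.ofReal_le_ofReal (sin_sq_div_le_cauchy hR ξ)
    _ = ENNReal.ofReal (∫ ξ : ℝ, 2 * R / π * (1 + (R * ξ) ^ 2)⁻¹) :=
        (ofReal_integral_eq_lintegral_ofReal hint (ae_of_all _ fun ξ => by positivity)).symm
    _ = 2 := by
        rw [integral_const_mul, Measure.integral_comp_mul_left (fun x : ℝ => (1 + x ^ 2)⁻¹) R,
          integral_univ_inv_one_add_sq, abs_of_pos (inv_pos.mpr hR), smul_eq_mul,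
          show 2 * R / π * (R⁻¹ * π) = 2 by field_simp]
        simp

/-- The kernels `sin² (R ξ) / (π R ξ²)` concentrate at `0`, where `φ` vanishes. -/
lemma tendsto_lintegral_sin_sq_div_mul {φ : ℝ → ℝ}
    (hφnn : ∀ x, 0 ≤ φ x) (hφcont : ContinuousAt φ 0) (hφ0 : φ 0 = 0)
    (hφint : ∀ δ : ℝ, 0 < δ → IntegrableOn (fun ξ => φ ξ / ξ ^ 2) {ξ : ℝ | δ ≤ |ξ|}) :
    Tendsto (fun R : ℝ => ∫⁻ ξ : ℝ, ENNReal.ofReal (sin (R * ξ) ^ 2 / (π * R * ξ ^ 2) * φ ξ))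
      atTop (nhds 0) := by
  refine ENNReal.tendsto_nhds_zero.mpr fun ε hε => ?_
  obtain ⟨η, hη, hηε⟩ : ∃ η : ℝ, 0 < η ∧ ENNReal.ofReal η * 2 < ε := by
    have h : Tendsto (fun η : ℝ => ENNReal.ofReal η * 2) (nhdsWithin 0 (Set.Ioi 0)) (nhds 0) := by
      have := ENNReal.Tendsto.mul_const (b := 2)
        (ENNReal.tendsto_ofReal (tendsto_id (α := ℝ) (x := nhds 0))) (Or.inr (by simp))
      simp only [ENNReal.ofReal_zero, zero_mul] at this
      exact this.mono_left nhdsWithin_le_nhds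
    exact (eventually_mem_nhdsWithin.and (h.eventually_lt_const hε)).exists
  obtain ⟨δ, hδ, hφδ⟩ := Metric.continuousAt_iff.mp hφcont η hη
  have hS : MeasurableSet {ξ : ℝ | δ ≤ |ξ|} := measurableSet_le measurable_const measurable_abs
  set K := ∫⁻ ξ in {ξ : ℝ | δ ≤ |ξ|}, ENNReal.ofReal (φ ξ / ξ ^ 2) with hK
  have hKtop : K ≠ ⊤ := (hφint δ hδ).lintegral_lt_top.ne
  have hlim : Tendsto (fun R : ℝ => ENNReal.ofReal η * 2 + ENNReal.ofReal ((π * R)⁻¹) * K)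
      atTop (nhds (ENNReal.ofReal η * 2)) := by
    have h : Tendsto (fun R : ℝ => (π * R)⁻¹) atTop (nhds 0) :=
      tendsto_inv_atTop_zero.comp (tendsto_id.const_mul_atTop pi_pos)
    simpa using tendsto_const_nhds.add
      (ENNReal.Tendsto.mul_const (ENNReal.tendsto_ofReal h) (Or.inr hKtop))
  filter_upwards [hlim.eventually_lt_const hηε, eventually_gt_atTop 0] with R hRε hR
  refine le_trans ?_ hRε.le
  rw [← lintegral_add_compl _ hS, add_comm]
  refine add_le_add ?_ ?_
  · calc _ ≤ ∫⁻ ξ in {ξ : ℝ | δ ≤ |ξ|}ᶜ,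
            ENNReal.ofReal η * ENNReal.ofReal (sin (R * ξ) ^ 2 / (π * R * ξ ^ 2)) := by
          refine setLIntegral_mono' hS.compl fun ξ hξ => ?_
          rw [← ENNReal.ofReal_mul hη.le, mul_comm η]
          have hξ' : |ξ| < δ := not_le.mp hξ
          have := hφδ (x := ξ) (by simpa using hξ')
          rw [hφ0, dist_zero_right, norm_eq_abs] at this
          gcongr
          exact (le_abs_self _).trans this.le
      _ ≤ ∫⁻ ξ : ℝ, ENNReal.ofReal η * ENNReal.ofReal (sin (R * ξ) ^ 2 / (π * R * ξ ^ 2)) :=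
          setLIntegral_le_lintegral _ _
      _ ≤ _ := by
          rw [lintegral_const_mul' _ _ ENNReal.ofReal_ne_top]
          gcongr
          exact lintegral_sin_sq_div_le hR
  · rw [hK, ← lintegral_const_mul' _ _ ENNReal.ofReal_ne_top]
    refine lintegral_mono fun ξ => ?_
    rw [← ENNReal.ofReal_mul (by positivity)]
    refine ENNReal.ofReal_le_ofReal ?_
    calc _ = sin (R * ξ) ^ 2 * ((π * R)⁻¹ * (φ ξ / ξ ^ 2)) := by
          simp only [div_eq_mul_inv, mul_inv]; ring
      _ ≤ 1 * ((π * R)⁻¹ * (φ ξ / ξ ^ 2)) := by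
          have := hφnn ξ
          gcongr
          exact sin_sq_le_one _
      _ = _ := one_mul _

lemma lintegral_Icc_comp_sub_lt_top {γ₀ : ℝ → ℝ} (hγloc : LocallyIntegrable γ₀) (t : ℝ) :
    ∫⁻ r in Set.Icc (0 : ℝ) t, ∫⁻ v in Set.Icc (0 : ℝ) t, ENNReal.ofReal (γ₀ (r - v)) < ⊤ := by
  have hfin : ∫⁻ x in Set.Icc (-t) t, ENNReal.ofReal (γ₀ x) < ⊤ :=
    (hγloc.integrableOn_isCompact isCompact_Icc).lintegral_lt_top
  have hinner : ∀ r ∈ Set.Icc (0 : ℝ) t, ∫⁻ v in Set.Icc (0 : ℝ) t, ENNReal.ofReal (γ₀ (r - v)) ≤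
      ∫⁻ x in Set.Icc (-t) t, ENNReal.ofReal (γ₀ x) := by
    intro r hr
    rw [← lintegral_indicator measurableSet_Icc, ← lintegral_indicator measurableSet_Icc,
      ← lintegral_sub_left_eq_self ((Set.Icc (-t) t).indicator fun x => ENNReal.ofReal (γ₀ x)) r]
    refine lintegral_mono (Set.indicator_le fun v hv => ?_)
    rw [Set.indicator_of_mem]
    exact ⟨by linarith [hr.1, hv.2], by linarith [hr.2, hv.1]⟩
  calc _ ≤ ∫⁻ _ in Set.Icc (0 : ℝ) t, ∫⁻ x in Set.Icc (-t) t, ENNReal.ofReal (γ₀ x) :=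
        setLIntegral_mono' measurableSet_Icc hinner
    _ < ⊤ := by
        rw [setLIntegral_const]
        exact ENNReal.mul_lt_top hfin measure_Icc_lt_top

/-- For every t > 0,
lim_{R → ∞} ∫_{[0,t]²} γ₀(r − v) ( ∫_ℝ ℓ_R(ξ) φ(ξ) exp(−(r+v)ξ²/2) dξ ) dr dv = 0,
where ℓ_R(ξ) = sin²(Rξ)/(π R ξ²). -/
theorem first_chaos_variance_negligible (φ : ℝ → ℝ) (hφm : Measurable φ)
    (hφnn : ∀ x, 0 ≤ φ x) (hφcont : ContinuousAt φ 0) (hφ0 : φ 0 = 0)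
    (hφint : ∀ δ : ℝ, 0 < δ →
      MeasureTheory.IntegrableOn (fun ξ => φ ξ / ξ ^ 2) {ξ : ℝ | δ ≤ |ξ|})
    (γ₀ : ℝ → ℝ) (hγm : Measurable γ₀) (hγnn : ∀ x, 0 ≤ γ₀ x)
    (hγloc : MeasureTheory.LocallyIntegrable γ₀) :
    ∀ t : ℝ, 0 < t →
      Tendsto (fun R : ℝ =>
          ∫⁻ r in Set.Icc (0:ℝ) t, ∫⁻ v in Set.Icc (0:ℝ) t,
            ENNReal.ofReal (γ₀ (r - v)) *
              ∫⁻ ξ : ℝ, ENNReal.ofReal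
                (Real.sin (R * ξ) ^ 2 / (Real.pi * R * ξ ^ 2) * φ ξ *
                  Real.exp (-(r + v) * ξ ^ 2 / 2)))
        atTop (nhds 0) := by
  intro t _
  have hlim := ENNReal.Tendsto.const_mul
    (tendsto_lintegral_sin_sq_div_mul hφnn hφcont hφ0 hφint)
    (Or.inr (lintegral_Icc_comp_sub_lt_top hγloc t).ne)
  rw [mul_zero] at hlim
  refine tendsto_of_tendsto_of_tendsto_of_le_of_le' tendsto_const_nhds hlim
    (Eventually.of_forall fun _ => zero_le) ?_
  filter_upwards [eventually_gt_atTop 0] with R hR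
  have hmeas : Measurable fun p : ℝ × ℝ => ENNReal.ofReal (γ₀ (p.1 - p.2)) := by fun_prop
  rw [← lintegral_mul_const _ hmeas.lintegral_prod_right']
  refine setLIntegral_mono' measurableSet_Icc fun r hr => ?_
  rw [← lintegral_mul_const _ (by fun_prop)]
  refine setLIntegral_mono' measurableSet_Icc fun v hv => ?_
  refine mul_le_mul' le_rfl (lintegral_mono fun ξ => ENNReal.ofReal_le_ofReal ?_)
  refine mul_le_of_le_one_right ?_ (exp_le_one_iff.mpr ?_)
  · have := hφnn ξ
    positivity
  · nlinarith [mul_nonneg (add_nonneg hr.1 hv.1) (sq_nonneg ξ)]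
end

section
/- Let Θ, φ : ℝ → [0,∞] be Lebesgue measurable, let t > 0 and let p ≥ 1 be an integer. Then ∫_{[0,t]^p} ∫_{ℝ^p} Θ(ξ₁ + ⋯ + ξ_p) ( ∏_{j=1}^p φ(ξ_j) ) exp( −(1/2) Σ_{i,j=1}^p ξ_i ξ_j min(s_i, s_j) ) dξ ds = p! ∫_{SIM_p(t)} ∫_{ℝ^p} Θ(η_p) exp( −(1/2) Σ_{k=1}^p w_k η_k² ) ∏_{j=1}^p φ(η_j − η_{j−1}) dη dw, where η₀ = 0. -/
open MeasureTheory Real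

/-- A real matrix of determinant one preserves Lebesgue measure. -/
lemma measurePreserving_mulVec_of_det_eq_one {ι : Type*} [Fintype ι] [DecidableEq ι]
    (M : Matrix ι ι ℝ) (hM : M.det = 1) :
    MeasurePreserving (fun v : ι → ℝ => M.mulVec v) volume volume := by
  have h := Real.map_matrix_volume_pi_eq_smul_volume_pi (M := M) (by simp [hM])
  refine ⟨(Matrix.toLin' M).continuous_of_finiteDimensional.measurable, ?_⟩
  change Measure.map (Matrix.toLin' M) volume = volume
  simpa [hM] using h

lemma measurePreserving_sum_Ici (p : ℕ) :
    MeasurePreserving (fun (w : Fin p → ℝ) i => ∑ k ∈ Finset.Ici i, w k) volume volume := by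
  let M : Matrix (Fin p) (Fin p) ℝ := Matrix.of fun i k => if i ≤ k then 1 else 0
  have hM : M.det = 1 := by
    rw [Matrix.det_of_isUpperTriangular]
    · simp [M]
    · intro i j hij
      simpa [M] using hij
  convert measurePreserving_mulVec_of_det_eq_one M hM using 1
  ext w i
  simp [M, Matrix.mulVec, dotProduct, ← Finset.sum_filter, Finset.filter_le_eq_Ici]

lemma measurePreserving_sum_Iic (p : ℕ) :
    MeasurePreserving (fun (ξ : Fin p → ℝ) j => ∑ i ∈ Finset.Iic j, ξ i) volume volume := by
  let M : Matrix (Fin p) (Fin p) ℝ := Matrix.of fun j i => if i ≤ j then 1 else 0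
  have hM : M.det = 1 := by
    rw [Matrix.det_of_isLowerTriangular]
    · simp [M]
    · intro i j hij
      simpa [M] using hij
  convert measurePreserving_mulVec_of_det_eq_one M hM using 1
  ext ξ j
  simp [M, Matrix.mulVec, dotProduct, ← Finset.sum_filter, Finset.filter_ge_eq_Iic]

lemma measurePreserving_comp_perm {ι : Type*} [Fintype ι] (σ : Equiv.Perm ι) :
    MeasurePreserving (fun s : ι → ℝ => s ∘ σ) volume volume := by
  convert volume_measurePreserving_piCongrLeft (fun _ : ι => ℝ) σ.symm using 1
  ext s i
  obtain ⟨j, rfl⟩ := σ.symm.surjective i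
  rw [MeasurableEquiv.coe_piCongrLeft, Equiv.piCongrLeft_apply_apply]
  simp

lemma ae_injective {ι : Type*} [Fintype ι] :
    ∀ᵐ s : ι → ℝ, Function.Injective s := by
  classical
  have h : ∀ i j : ι, i ≠ j → ∀ᵐ s : ι → ℝ, s i ≠ s j := by
    intro i j hij
    let L : (ι → ℝ) →ₗ[ℝ] ℝ :=
      (LinearMap.proj i : (ι → ℝ) →ₗ[ℝ] ℝ) - (LinearMap.proj j : (ι → ℝ) →ₗ[ℝ] ℝ)
    have hL : L.ker ≠ ⊤ := by
      intro hker
      have hmem : Pi.single i (1 : ℝ) ∈ L.ker := hker ▸ Submodule.mem_top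
      simp [L, hij.symm] at hmem
    have hnull := Measure.addHaar_submodule (volume : Measure (ι → ℝ)) L.ker hL
    rw [ae_iff]
    convert hnull using 2
    ext s
    simp [L, sub_eq_zero]
  have h' : ∀ᵐ s : ι → ℝ, ∀ i j, i ≠ j → s i ≠ s j := by
    simpa only [ae_all_iff] using h
  filter_upwards [h'] with s hs i j hij
  exact by_contra fun hne => hs i j hne hij

lemma existsUnique_perm_antitone {n : ℕ} {s : Fin n → ℝ} (hs : Function.Injective s) :
    ∃! σ : Equiv.Perm (Fin n), Antitone (s ∘ σ) := by
  refine ⟨Tuple.sort (-s), ?_, fun τ hτ => ?_⟩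
  · intro i j hij
    simpa using Tuple.monotone_sort (-s) hij
  · have hσ : Antitone (s ∘ Tuple.sort (-s)) := fun i j hij => by
      simpa using Tuple.monotone_sort (-s) hij
    exact Equiv.ext fun i => hs (congrFun (Tuple.unique_antitone hτ hσ) i)

lemma measurableSet_antitone (n : ℕ) : MeasurableSet {s : Fin n → ℝ | Antitone s} := by
  have h : {s : Fin n → ℝ | Antitone s} = ⋂ i, ⋂ j, ⋂ _ : i ≤ j, {s | s j ≤ s i} := by
    ext s
    simp [Antitone]
  rw [h]
  exact .iInter fun i => .iInter fun j => .iInter fun _ =>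
    measurableSet_le (measurable_pi_apply j) (measurable_pi_apply i)

/-- The integral of a symmetric function is `n!` times its integral over decreasing tuples. -/
lemma lintegral_eq_factorial_mul_setLIntegral_antitone {n : ℕ} {f : (Fin n → ℝ) → ENNReal}
    (hf : Measurable f) (hsymm : ∀ (σ : Equiv.Perm (Fin n)) s, f (s ∘ σ) = f s) :
    ∫⁻ s, f s = n.factorial * ∫⁻ s in {s | Antitone s}, f s := by
  have hE := measurableSet_antitone n
  have hind : Measurable ({s : Fin n → ℝ | Antitone s}.indicator f) := hf.indicator hE
  calc ∫⁻ s, f s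
      = ∫⁻ s, ∑ σ : Equiv.Perm (Fin n), {s : Fin n → ℝ | Antitone s}.indicator f (s ∘ σ) := by
        refine lintegral_congr_ae ?_
        filter_upwards [ae_injective] with s hs
        obtain ⟨σ, hσ, huniq⟩ := existsUnique_perm_antitone hs
        rw [Finset.sum_eq_single σ]
        · rw [Set.indicator_of_mem (by exact hσ), hsymm]
        · intro τ _ hτ
          exact Set.indicator_of_notMem (fun h => hτ (huniq τ h)) _
        · simp
    _ = ∑ σ : Equiv.Perm (Fin n), ∫⁻ s, {s : Fin n → ℝ | Antitone s}.indicator f (s ∘ σ) :=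
        lintegral_finsetSum _ fun σ _ => hind.comp (measurePreserving_comp_perm σ).measurable
    _ = n.factorial * ∫⁻ s in {s | Antitone s}, f s := by
        simp_rw [fun σ : Equiv.Perm (Fin n) =>
          (measurePreserving_comp_perm σ).lintegral_comp hind]
        simp [lintegral_indicator hE, Fintype.card_perm]

lemma antitone_sum_Ici_mem_cube_iff {p : ℕ} (hp : 1 ≤ p) (t : ℝ) (w : Fin p → ℝ) :
    ((∀ i, 0 ≤ ∑ k ∈ Finset.Ici i, w k ∧ ∑ k ∈ Finset.Ici i, w k ≤ t) ∧
      Antitone fun i => ∑ k ∈ Finset.Ici i, w k) ↔ (∀ k, 0 ≤ w k) ∧ ∑ k, w k ≤ t := by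
  have hzero : Finset.Ici (⟨0, hp⟩ : Fin p) = Finset.univ := by
    ext k
    simp [Fin.le_def]
  constructor
  · rintro ⟨hcube, hanti⟩
    refine ⟨fun k => ?_, by simpa [hzero] using (hcube ⟨0, hp⟩).2⟩
    have hsplit := Finset.add_sum_Ioi_eq_sum_Ici (f := w) k
    by_cases hk : (k : ℕ) + 1 < p
    · have hsucc : Finset.Ioi k = Finset.Ici ⟨k + 1, hk⟩ := by
        ext j
        simp only [Finset.mem_Ioi, Finset.mem_Ici, Fin.le_def, Fin.lt_def, Nat.succ_le_iff]
      have := hanti (show k ≤ ⟨k + 1, hk⟩ by simp [Fin.le_def])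
      dsimp only at this
      rw [← hsucc] at this
      linarith
    · have hempty : Finset.Ioi k = ∅ := by
        ext j
        simp only [Finset.mem_Ioi, Fin.lt_def, Finset.notMem_empty, iff_false]
        omega
      have := (hcube k).1
      simp only [hempty, Finset.sum_empty] at hsplit
      linarith
  · rintro ⟨hw, hsum⟩
    refine ⟨fun i => ⟨Finset.sum_nonneg fun k _ => hw k, ?_⟩, fun i j hij => ?_⟩
    · exact (Finset.sum_le_univ_sum_of_nonneg hw).trans hsum
    · exact Finset.sum_le_sum_of_subset_of_nonneg (Finset.Ici_subset_Ici.2 hij) fun k _ _ => hw k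

lemma sum_mul_mul_min_sum_Ici {p : ℕ} {w : Fin p → ℝ} (hw : ∀ k, 0 ≤ w k) (ξ : Fin p → ℝ) :
    ∑ i, ∑ j, ξ i * ξ j * min (∑ k ∈ Finset.Ici i, w k) (∑ k ∈ Finset.Ici j, w k) =
      ∑ k, w k * (∑ i ∈ Finset.Iic k, ξ i) ^ 2 := by
  have hanti : Antitone fun i => ∑ k ∈ Finset.Ici i, w k := fun i j hij =>
    Finset.sum_le_sum_of_subset_of_nonneg (Finset.Ici_subset_Ici.2 hij) fun k _ _ => hw k
  have hmin : ∀ i j, min (∑ k ∈ Finset.Ici i, w k) (∑ k ∈ Finset.Ici j, w k) =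
      ∑ k, if i ≤ k ∧ j ≤ k then w k else 0 := by
    intro i j
    rw [← hanti.map_max, ← Finset.filter_le_eq_Ici, Finset.sum_filter]
    simp only [max_le_iff]
  have hsq : ∀ k, w k * (∑ i ∈ Finset.Iic k, ξ i) ^ 2 =
      ∑ i, ∑ j, ξ i * ξ j * if i ≤ k ∧ j ≤ k then w k else 0 := by
    intro k
    rw [← Finset.filter_ge_eq_Iic, Finset.sum_filter, sq, Finset.sum_mul_sum, Finset.mul_sum]
    refine Finset.sum_congr rfl fun i _ => ?_
    rw [Finset.mul_sum]
    refine Finset.sum_congr rfl fun j _ => ?_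
    by_cases hi : i ≤ k <;> by_cases hj : j ≤ k <;> simp [hi, hj]
    ring
  simp_rw [hmin, hsq, Finset.mul_sum]
  calc _ = ∑ i, ∑ k, ∑ j, ξ i * ξ j * (if i ≤ k ∧ j ≤ k then w k else 0) :=
        Finset.sum_congr rfl fun i _ => Finset.sum_comm
    _ = _ := Finset.sum_comm

lemma sum_Iic_sub_prev {p : ℕ} (ξ : Fin p → ℝ) (j : Fin p) (hj : (j : ℕ) - 1 < p) :
    (∑ i ∈ Finset.Iic j, ξ i) - (if _h : (j : ℕ) = 0 then 0 else
      ∑ i ∈ Finset.Iic (⟨(j : ℕ) - 1, hj⟩ : Fin p), ξ i) = ξ j := by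
  rw [← Finset.add_sum_Iio_eq_sum_Iic]
  split_ifs with h
  · have hempty : Finset.Iio j = ∅ := by
      ext i
      simp [Fin.lt_def, h]
    simp [hempty]
  · have hpred : Finset.Iio j = Finset.Iic ⟨(j : ℕ) - 1, hj⟩ := by
      ext i
      simp only [Finset.mem_Iio, Finset.mem_Iic, Fin.lt_def, Fin.le_def]
      omega
    simp [hpred]

/-- Change-of-variables identity:
∫_{[0,t]^p} ∫_{ℝ^p} Θ(ξ₁+⋯+ξ_p) (∏ φ(ξ_j)) exp(−½ Σ_{i,j} ξ_i ξ_j min(s_i,s_j)) dξ ds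
= p! ∫_{SIM_p(t)} ∫_{ℝ^p} Θ(η_p) exp(−½ Σ_k w_k η_k²) ∏ φ(η_j − η_{j−1}) dη dw,
with η₀ = 0 and SIM_p(t) = { w ∈ [0,∞)^p : Σ w_k ≤ t }. -/
theorem symmetrization_change_of_variables (Θ φ : ℝ → ENNReal)
    (hΘ : Measurable Θ) (hφ : Measurable φ) (t : ℝ) (ht : 0 < t)
    (p : ℕ) (hp : 1 ≤ p) :
    (∫⁻ s in Set.pi Set.univ (fun _ : Fin p => Set.Icc (0:ℝ) t),
      ∫⁻ ξ : Fin p → ℝ,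
        Θ (∑ j, ξ j) * (∏ j, φ (ξ j)) *
          ENNReal.ofReal
            (Real.exp (-(1/2) * ∑ i, ∑ j, ξ i * ξ j * min (s i) (s j))))
      = (p.factorial : ENNReal) *
        ∫⁻ w in {w : Fin p → ℝ | (∀ k, 0 ≤ w k) ∧ (∑ k, w k) ≤ t},
          ∫⁻ η : Fin p → ℝ,
            Θ (η ⟨p - 1, by omega⟩) *
              ENNReal.ofReal (Real.exp (-(1/2) * ∑ k, w k * (η k) ^ 2)) *
              ∏ j : Fin p, φ (η j -
                (if h : (j : ℕ) = 0 then 0 else η ⟨(j : ℕ) - 1, by have := j.isLt; omega⟩)) := by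
  let F : (Fin p → ℝ) → (Fin p → ℝ) → ENNReal := fun s ξ =>
    Θ (∑ j, ξ j) * (∏ j, φ (ξ j)) *
      ENNReal.ofReal (Real.exp (-(1/2) * ∑ i, ∑ j, ξ i * ξ j * min (s i) (s j)))
  let C : Set (Fin p → ℝ) := Set.pi Set.univ fun _ => Set.Icc 0 t
  have hC : MeasurableSet C := MeasurableSet.univ_pi fun _ => measurableSet_Icc
  have hA := measurableSet_antitone p
  have hG : Measurable fun s => ∫⁻ ξ, F s ξ := by
    refine Measurable.lintegral_prod_right' (f := fun q : (Fin p → ℝ) × (Fin p → ℝ) => F q.1 q.2) ?_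
    dsimp only [F]
    fun_prop
  have hsymm : ∀ (σ : Equiv.Perm (Fin p)) s, ∫⁻ ξ, F (s ∘ σ) ξ = ∫⁻ ξ, F s ξ := by
    intro σ s
    have hFs : Measurable (F (s ∘ σ)) := by
      dsimp only [F]
      fun_prop
    rw [← (measurePreserving_comp_perm σ).lintegral_comp hFs]
    refine lintegral_congr fun ξ => ?_
    dsimp only [F, Function.comp_apply]
    rw [Equiv.sum_comp σ ξ, Equiv.prod_comp σ fun j => φ (ξ j),
      ← Equiv.sum_comp σ fun i => ∑ j, ξ i * ξ j * min (s i) (s j)]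
    simp_rw [fun i => Equiv.sum_comp σ fun j => ξ (σ i) * ξ j * min (s (σ i)) (s j)]
  have hCsymm : ∀ (σ : Equiv.Perm (Fin p)) s, s ∘ σ ∈ C ↔ s ∈ C := by
    intro σ s
    simpa only [C, Set.mem_univ_pi, Function.comp_apply] using
      σ.forall_congr_right (q := fun i => s i ∈ Set.Icc 0 t)
  have hGC : Measurable (C.indicator fun s => ∫⁻ ξ, F s ξ) := hG.indicator hC
  change ∫⁻ s in C, ∫⁻ ξ, F s ξ = _
  rw [← lintegral_indicator hC, lintegral_eq_factorial_mul_setLIntegral_antitone hGC,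
    ← lintegral_indicator hA, ← (measurePreserving_sum_Ici p).lintegral_comp (hGC.indicator hA)]
  swap
  · intro σ s
    by_cases hs : s ∈ C
    · rw [Set.indicator_of_mem hs, Set.indicator_of_mem ((hCsymm σ s).2 hs), hsymm]
    · rw [Set.indicator_of_notMem hs, Set.indicator_of_notMem (mt (hCsymm σ s).1 hs)]
  have hS : MeasurableSet {w : Fin p → ℝ | (∀ k, 0 ≤ w k) ∧ ∑ k, w k ≤ t} := by
    measurability
  rw [← lintegral_indicator hS]
  congr 1
  refine lintegral_congr fun w => ?_
  have hmem := antitone_sum_Ici_mem_cube_iff hp t w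
  by_cases hw : (∀ k, 0 ≤ w k) ∧ ∑ k, w k ≤ t
  · obtain ⟨hcube, hanti⟩ := hmem.2 hw
    rw [Set.indicator_of_mem (by exact hanti), Set.indicator_of_mem (by exact fun i _ => hcube i),
      Set.indicator_of_mem (by exact hw)]
    refine Eq.trans ?_ ((measurePreserving_sum_Iic p).lintegral_comp ?_)
    · refine lintegral_congr fun ξ => ?_
      have hlast : Finset.Iic (⟨p - 1, by omega⟩ : Fin p) = Finset.univ := by
        ext i
        simp [Fin.le_def]
        omega
      dsimp only [F]
      simp_rw [sum_mul_mul_min_sum_Ici hw.1, sum_Iic_sub_prev, hlast]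
      ring
    · refine ((hΘ.comp (measurable_pi_apply _)).mul (by fun_prop)).mul
        (Finset.measurable_fun_prod _ fun j _ => hφ.comp ?_)
      split_ifs <;> fun_prop
  · rw [Set.indicator_of_notMem (s := {w : Fin p → ℝ | (∀ k, 0 ≤ w k) ∧ ∑ k, w k ≤ t}) (by exact hw),
      Set.indicator_indicator, Set.indicator_of_notMem]
    rintro ⟨hanti, hcube⟩
    exact hw (hmem.1 ⟨fun i => hcube i trivial, hanti⟩)
end

section
/- For every t > 0, every integer p ≥ 1 and every N > 0, K_{1,p}(1, t) ≤ (p!/(2κ₀)) (8 κ₀ C_N)^p exp( t D_N / (2 C_N) ), where C_N = ∫_{{|η| ≥ N}} (1 + φ(η) + φ(η)²)/η² dη and D_N = ∫_{{|η| ≤ N}} (1 + φ(η) + φ(η)²) dη (both finite, and C_N > 0). -/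
open MeasureTheory Real

theorem measurable_fin_prod_eval {n : ℕ} {f : Fin n → ℝ → ENNReal}
    (hf : ∀ i, Measurable (f i)) : Measurable fun x : Fin n → ℝ => ∏ i, f i (x i) :=
  Finset.measurable_fun_prod _ fun i _ => (hf i).comp (measurable_pi_apply i)

/-- Tonelli's theorem for a product of functions of the separate coordinates. -/
theorem lintegral_fin_prod_eq_prod_lintegral (n : ℕ) (f : Fin n → ℝ → ENNReal)
    (hf : ∀ i, Measurable (f i)) :
    ∫⁻ x : Fin n → ℝ, ∏ i, f i (x i) = ∏ i, ∫⁻ x, f i x := by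
  induction n with
  | zero => simp [volume_pi]
  | succ n ih =>
    rw [← ((volume_preserving_piFinSuccAbove (fun _ : Fin (n + 1) => ℝ) 0).symm).lintegral_comp
      (measurable_fin_prod_eval hf)]
    simp only [Fin.prod_univ_succ, MeasurableEquiv.piFinSuccAbove_symm_apply,
      Fin.insertNthEquiv, Fin.zero_succAbove, Equiv.coe_fn_mk, Fin.insertNth_zero', Fin.cons_zero,
      Fin.cons_succ]
    rw [← ih (fun i => f i.succ) fun i => hf _]
    exact lintegral_prod_mul (hf 0).aemeasurable
      (measurable_fin_prod_eval fun i => hf i.succ).aemeasurable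

/-- The increments of `φ` along a path started at `0` are controlled by a product of one-point
weights; the factor `1 + φ` at the endpoint makes the bound inductive. -/
theorem prod_increment_mul_le {φ : ℝ → ℝ} (hφnn : ∀ x, 0 ≤ φ x) (hφeven : ∀ x, φ (-x) = φ x)
    {κ₀ : ℝ} (hκ : 0 < κ₀) (hconc : ∀ x y : ℝ, φ (x + y) ≤ κ₀ * (φ x + φ y))
    (m : ℕ) (η : Fin (m + 1) → ℝ) :
    (∏ j : Fin (m + 1), φ (η j -
        (if h : (j : ℕ) = 0 then 0 else η ⟨(j : ℕ) - 1, by have := j.isLt; omega⟩))) *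
        (1 + φ (η (Fin.last m)))
      ≤ (2 * κ₀) ^ m * ∏ j, (1 + φ (η j) + φ (η j) ^ 2) := by
  induction m with
  | zero => simp; nlinarith [hφnn (η 0)]
  | succ m ih =>
    have h := ih (fun i => η i.castSucc)
    rw [Fin.prod_univ_castSucc, Fin.prod_univ_castSucc (n := m + 1)]
    simp only [Fin.val_castSucc, Fin.val_last, Nat.add_eq_zero_iff, one_ne_zero, and_false,
      dite_false]
    simp only [Fin.castSucc_mk] at h
    set P := ∏ j : Fin (m + 1), φ (η j.castSucc -
        (if h : (j : ℕ) = 0 then 0 else η ⟨(j : ℕ) - 1, by have := j.isLt; omega⟩)) 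
    have hP0 : 0 ≤ P := Finset.prod_nonneg fun _ _ => hφnn _
    set a := φ (η (Fin.last m).castSucc)
    set b := φ (η (Fin.last (m + 1)))
    have ha0 : 0 ≤ a := hφnn _
    have hb0 : 0 ≤ b := hφnn _
    set Q := ∏ j : Fin (m + 1), (1 + φ (η j.castSucc) + φ (η j.castSucc) ^ 2)
    have hinc : φ (η (Fin.last (m + 1)) - η (Fin.last m).castSucc) ≤ κ₀ * ((1 + a) * (1 + b)) := by
      rw [sub_eq_add_neg]
      refine (hconc _ _).trans (mul_le_mul_of_nonneg_left ?_ hκ.le)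
      rw [hφeven]
      nlinarith
    calc P * φ (η (Fin.last (m + 1)) - η (Fin.last m).castSucc) * (1 + b)
        ≤ P * (κ₀ * ((1 + a) * (1 + b))) * (1 + b) := by gcongr
      _ = P * (1 + a) * (κ₀ * (1 + b) ^ 2) := by ring
      _ ≤ ((2 * κ₀) ^ m * Q) * (κ₀ * (2 * (1 + b + b ^ 2))) := by
          gcongr
          · exact (mul_nonneg hP0 (by linarith)).trans h
          · nlinarith
      _ = (2 * κ₀) ^ (m + 1) * (Q * (1 + b + b ^ 2)) := by ring

theorem prod_increment_le {φ : ℝ → ℝ} (hφnn : ∀ x, 0 ≤ φ x) (hφeven : ∀ x, φ (-x) = φ x)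
    {κ₀ : ℝ} (hκ : 0 < κ₀) (hconc : ∀ x y : ℝ, φ (x + y) ≤ κ₀ * (φ x + φ y))
    (m : ℕ) (η : Fin (m + 1) → ℝ) :
    (∏ j : Fin (m + 1), φ (η j -
        (if h : (j : ℕ) = 0 then 0 else η ⟨(j : ℕ) - 1, by have := j.isLt; omega⟩)))
      ≤ (2 * κ₀) ^ m * ∏ j, (1 + φ (η j) + φ (η j) ^ 2) :=
  (le_mul_of_one_le_right (Finset.prod_nonneg fun _ _ => hφnn _)
    (by linarith [hφnn (η (Fin.last m))])).trans
    (prod_increment_mul_le hφnn hφeven hκ hconc m η)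

theorem setLIntegral_Ici_exp_neg_mul {a : ℝ} (ha : 0 < a) :
    ∫⁻ w in Set.Ici (0 : ℝ), ENNReal.ofReal (exp (-a * w)) = ENNReal.ofReal a⁻¹ := by
  rw [← setLIntegral_congr (Ioi_ae_eq_Ici (μ := volume) (a := (0 : ℝ))),
    ← ofReal_integral_eq_lintegral_ofReal (integrableOn_exp_mul_Ioi (neg_neg_iff_pos.mpr ha) 0)
      (Filter.Eventually.of_forall fun _ => (exp_pos _).le),
    integral_exp_mul_Ioi (neg_neg_iff_pos.mpr ha)]
  simp

/-- The one-coordinate factor of the exponentially tilted integral. -/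
theorem lintegral_tilt_gaussian_le {g : ℝ → ℝ} (hgm : Measurable g) (hg : ∀ x, 0 ≤ g x)
    {N β : ℝ} (hN : 0 < N) (hβ : 0 < β) (hD : IntegrableOn g (Set.Icc (-N) N))
    (hC : IntegrableOn (fun x => g x / x ^ 2) {x : ℝ | N ≤ |x|}) :
    ∫⁻ w, (Set.Ici (0 : ℝ)).indicator (fun w => ENNReal.ofReal (exp (-β * w))) w *
        ∫⁻ x, ENNReal.ofReal (exp (-(1 / 2) * (w * x ^ 2))) * ENNReal.ofReal (g x)
      ≤ ENNReal.ofReal ((∫ x in Set.Icc (-N) N, g x) / β +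
          2 * ∫ x in {x : ℝ | N ≤ |x|}, g x / x ^ 2) := by
  have hpt : ∀ x : ℝ, ∫⁻ w in Set.Ici (0 : ℝ), ENNReal.ofReal (exp (-β * w)) *
      (ENNReal.ofReal (exp (-(1 / 2) * (w * x ^ 2))) * ENNReal.ofReal (g x)) =
      ENNReal.ofReal (g x / (β + x ^ 2 / 2)) := by
    intro x
    have hpos : 0 < β + x ^ 2 / 2 := by positivity
    rw [div_eq_inv_mul (g x), ENNReal.ofReal_mul (by positivity), ← setLIntegral_Ici_exp_neg_mul hpos,
      ← lintegral_mul_const _ (by fun_prop)]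
    refine lintegral_congr fun w => ?_
    rw [← mul_assoc, ← ENNReal.ofReal_mul (exp_pos _).le, ← exp_add]
    congr 3
    ring
  have hS : MeasurableSet {x : ℝ | N ≤ |x|} := measurableSet_le measurable_const (by fun_prop)
  calc _ = ∫⁻ w in Set.Ici (0 : ℝ), ∫⁻ x, ENNReal.ofReal (exp (-β * w)) *
        (ENNReal.ofReal (exp (-(1 / 2) * (w * x ^ 2))) * ENNReal.ofReal (g x)) := by
        rw [← lintegral_indicator measurableSet_Ici]
        refine lintegral_congr fun w => ?_
        by_cases hw : w ∈ Set.Ici (0 : ℝ)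
        · simp only [Set.indicator_of_mem hw]
          rw [lintegral_const_mul _ (by fun_prop)]
        · simp only [Set.indicator_of_notMem hw, zero_mul]
    _ = ∫⁻ x, ENNReal.ofReal (g x / (β + x ^ 2 / 2)) := by
        rw [lintegral_lintegral_swap (by fun_prop)]
        exact lintegral_congr hpt
    _ ≤ (∫⁻ x in Set.Icc (-N) N, ENNReal.ofReal (g x / (β + x ^ 2 / 2))) +
        ∫⁻ x in {x : ℝ | N ≤ |x|}, ENNReal.ofReal (g x / (β + x ^ 2 / 2)) := by
        rw [← setLIntegral_univ]
        refine (lintegral_mono_set fun x _ => ?_).trans (lintegral_union_le _ _ _)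
        rcases le_total |x| N with h | h
        · exact Or.inl (abs_le.mp h)
        · exact Or.inr h
    _ ≤ (∫⁻ x in Set.Icc (-N) N, ENNReal.ofReal (g x / β)) +
        ∫⁻ x in {x : ℝ | N ≤ |x|}, ENNReal.ofReal (2 * (g x / x ^ 2)) := by
        refine add_le_add (lintegral_mono fun x => ENNReal.ofReal_le_ofReal ?_)
          (setLIntegral_mono (by fun_prop) fun x hx => ENNReal.ofReal_le_ofReal ?_)
        · exact div_le_div_of_nonneg_left (hg x) hβ (by nlinarith [sq_nonneg x])
        · have hx0 : 0 < x ^ 2 := by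
            have : x ≠ 0 := abs_pos.mp (hN.trans_le hx)
            positivity
          calc g x / (β + x ^ 2 / 2) ≤ g x / (x ^ 2 / 2) :=
                div_le_div_of_nonneg_left (hg x) (by positivity) (by linarith)
            _ = 2 * (g x / x ^ 2) := by field_simp
    _ = _ := by
        rw [← ofReal_integral_eq_lintegral_ofReal (hD.div_const β)
            (Filter.Eventually.of_forall fun x => div_nonneg (hg x) hβ.le),
          ← ofReal_integral_eq_lintegral_ofReal (hC.const_mul 2)
            (Filter.Eventually.of_forall fun x => by have := hg x; positivity),
          integral_div, integral_const_mul, ENNReal.ofReal_add]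
        · exact div_nonneg (integral_nonneg hg) hβ.le
        · exact mul_nonneg zero_le_two
            (integral_nonneg fun x => div_nonneg (hg x) (sq_nonneg x))

/-- Under the modified Dalang condition and the concavity condition on φ,
K_{1,p}(1,t) ≤ (p!/(2κ₀)) (8 κ₀ C_N)^p exp(t D_N/(2 C_N)), where
C_N = ∫_{|η| ≥ N} (1 + φ(η) + φ(η)²)/η² dη and D_N = ∫_{|η| ≤ N} (1 + φ(η) + φ(η)²) dη. -/
theorem K1p_one_bound (φ : ℝ → ℝ) (hφm : Measurable φ) (hφnn : ∀ x, 0 ≤ φ x)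
    (hφeven : ∀ x, φ (-x) = φ x)
    (hdalang : Integrable (fun x => (φ x) ^ 2 / (1 + x ^ 2)))
    (hdalang' : Integrable (fun x => φ x / (1 + x ^ 2)))
    (κ₀ : ℝ) (hκ : 0 < κ₀) (hconc : ∀ x y : ℝ, φ (x + y) ≤ κ₀ * (φ x + φ y))
    (t : ℝ) (ht : 0 < t) (p : ℕ) (hp : 1 ≤ p) (N : ℝ) (hN : 0 < N) :
    (p.factorial : ENNReal) *
      (∫⁻ w in {w : Fin p → ℝ | (∀ k, 0 ≤ w k) ∧ (∑ k, w k) ≤ t},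
        ∫⁻ η : Fin p → ℝ,
          ENNReal.ofReal (Real.exp (-(1/2) * ∑ k, w k * (η k) ^ 2)) *
            ∏ j : Fin p, ENNReal.ofReal
              (φ (η j -
                (if h : (j : ℕ) = 0 then 0 else η ⟨(j : ℕ) - 1, by have := j.isLt; omega⟩))))
      ≤ ENNReal.ofReal
          ((p.factorial : ℝ) / (2 * κ₀) *
            (8 * κ₀ * (∫ η in {η : ℝ | N ≤ |η|}, (1 + φ η + (φ η) ^ 2) / η ^ 2)) ^ p *
            Real.exp (t * (∫ η in Set.Icc (-N) N, (1 + φ η + (φ η) ^ 2)) /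
              (2 * (∫ η in {η : ℝ | N ≤ |η|}, (1 + φ η + (φ η) ^ 2) / η ^ 2)))) := by
  set g : ℝ → ℝ := fun x => 1 + φ x + φ x ^ 2 with hgdef
  have hg1 : ∀ x, 1 ≤ g x := fun x => by have := hφnn x; simp only [hgdef]; nlinarith
  have hg : ∀ x, 0 ≤ g x := fun x => zero_le_one.trans (hg1 x)
  have hgm : Measurable g := by fun_prop
  have hgi : Integrable (fun x => g x / (1 + x ^ 2)) := by
    refine ((integrable_inv_one_add_sq.add hdalang').add hdalang).congr
      (Filter.Eventually.of_forall fun x => ?_)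
    simp only [Pi.add_apply, hgdef]
    ring
  have hS : MeasurableSet {x : ℝ | N ≤ |x|} := measurableSet_le measurable_const (by fun_prop)
  have hDi : IntegrableOn g (Set.Icc (-N) N) := by
    refine Integrable.mono' (hgi.integrableOn.const_mul (1 + N ^ 2)) hgm.aestronglyMeasurable
      ((ae_restrict_iff' measurableSet_Icc).mpr (Filter.Eventually.of_forall fun x hx => ?_))
    rw [norm_of_nonneg (hg x), ← mul_div_assoc, le_div_iff₀ (by positivity), mul_comm]
    have : x ^ 2 ≤ N ^ 2 := sq_le_sq' hx.1 hx.2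
    exact mul_le_mul_of_nonneg_right (by linarith) (hg x)
  have hCi : IntegrableOn (fun x => g x / x ^ 2) {x : ℝ | N ≤ |x|} := by
    refine Integrable.mono' (hgi.integrableOn.const_mul ((1 + N ^ 2) / N ^ 2))
      (by fun_prop : Measurable _).aestronglyMeasurable
      ((ae_restrict_iff' hS).mpr (Filter.Eventually.of_forall fun x hx => ?_))
    have hNx : N ^ 2 ≤ x ^ 2 := by
      rw [← sq_abs x]; exact pow_le_pow_left₀ hN.le hx 2
    have hx0 : 0 < x ^ 2 := lt_of_lt_of_le (by positivity) hNx
    rw [norm_of_nonneg (div_nonneg (hg x) hx0.le), div_mul_div_comm,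
      div_le_div_iff₀ hx0 (by positivity)]
    nlinarith [mul_le_mul_of_nonneg_left hNx (hg x)]
  set C := ∫ η in {η : ℝ | N ≤ |η|}, (1 + φ η + (φ η) ^ 2) / η ^ 2
  set D := ∫ η in Set.Icc (-N) N, (1 + φ η + (φ η) ^ 2)
  have hDpos : 0 < D := by
    have h : ∫ x in Set.Icc (-N) N, (1 : ℝ) ≤ D :=
      setIntegral_mono_on (integrableOn_const (by simp)) hDi measurableSet_Icc fun x _ => hg1 x
    simp only [setIntegral_const, volume_real_Icc, smul_eq_mul, mul_one] at h
    rw [max_eq_left (by linarith)] at h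
    linarith
  have hCpos : 0 < C := by
    refine (setIntegral_pos_iff_support_of_nonneg_ae
      (Filter.Eventually.of_forall fun x => div_nonneg (hg x) (sq_nonneg x)) hCi).mpr ?_
    refine lt_of_lt_of_le (?_ : 0 < volume (Set.Icc N (N + 1))) (measure_mono fun x hx => ?_)
    · simp
    · have hx0 : 0 < x := hN.trans_le hx.1
      exact ⟨(div_pos (zero_lt_one.trans_le (hg1 x)) (by positivity)).ne',
        hx.1.trans (le_abs_self x)⟩
  obtain ⟨m, rfl⟩ : ∃ m, p = m + 1 := ⟨p - 1, by omega⟩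
  set β := D / (2 * C) with hβdef
  have hβ : 0 < β := by positivity
  set G : ℝ → ℝ → ENNReal := fun w x =>
    ENNReal.ofReal (exp (-(1 / 2) * (w * x ^ 2))) * ENNReal.ofReal (g x) with hG
  set E : ℝ → ENNReal :=
    (Set.Ici (0 : ℝ)).indicator (fun w => ENNReal.ofReal (exp (-β * w)))
  have hGm : ∀ w, Measurable (G w) := fun w => by fun_prop
  have hGm2 : Measurable (fun w => ∫⁻ x, G w x) := by
    refine Measurable.lintegral_prod_right ?_
    fun_prop
  have hEm : Measurable E := Measurable.indicator (by fun_prop) measurableSet_Ici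
  have hinner : ∀ w : Fin (m + 1) → ℝ, (∫⁻ η : Fin (m + 1) → ℝ,
          ENNReal.ofReal (Real.exp (-(1/2) * ∑ k, w k * (η k) ^ 2)) *
            ∏ j : Fin (m + 1), ENNReal.ofReal
              (φ (η j -
                (if h : (j : ℕ) = 0 then 0 else η ⟨(j : ℕ) - 1, by have := j.isLt; omega⟩))))
      ≤ ENNReal.ofReal ((2 * κ₀) ^ m) * ∏ k, ∫⁻ x, G (w k) x := by
    intro w
    rw [← lintegral_fin_prod_eq_prod_lintegral _ (fun k => G (w k)) fun k => hGm _,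
      ← lintegral_const_mul _ (measurable_fin_prod_eval fun k => hGm (w k))]
    refine lintegral_mono fun η => ?_
    simp only [hG]
    rw [Finset.prod_mul_distrib, ← ENNReal.ofReal_prod_of_nonneg fun _ _ => hφnn _,
      ← ENNReal.ofReal_prod_of_nonneg fun _ _ => hg _,
      ← ENNReal.ofReal_prod_of_nonneg fun _ _ => (exp_pos _).le, ← exp_sum, ← Finset.mul_sum,
      mul_left_comm, ← ENNReal.ofReal_mul (p := (2 * κ₀) ^ m) (by positivity)]
    exact mul_le_mul_right (ENNReal.ofReal_le_ofReal
      (prod_increment_le hφnn hφeven hκ hconc m η)) _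
  have hweight : ∀ w ∈ {w : Fin (m + 1) → ℝ | (∀ k, 0 ≤ w k) ∧ (∑ k, w k) ≤ t},
      1 ≤ ENNReal.ofReal (exp (β * t)) * ∏ k, E (w k) := by
    rintro w ⟨hw, hwt⟩
    have : ∀ k, E (w k) = ENNReal.ofReal (exp (-β * w k)) := fun k =>
      Set.indicator_of_mem (hw k) _
    simp only [this]
    rw [← ENNReal.ofReal_prod_of_nonneg fun _ _ => (exp_pos _).le,
      ← ENNReal.ofReal_mul (exp_pos _).le, ← exp_sum, ← exp_add, ← Finset.mul_sum,
      ENNReal.one_le_ofReal]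
    exact one_le_exp (by nlinarith)
  have hL : ∫⁻ w, E w * ∫⁻ x, G w x ≤ ENNReal.ofReal (4 * C) := by
    refine (lintegral_tilt_gaussian_le hgm hg hN hβ hDi hCi).trans
      (ENNReal.ofReal_le_ofReal (le_of_eq ?_))
    change D / β + 2 * C = 4 * C
    rw [hβdef]
    field_simp
    ring
  have hprodm : Measurable fun w : Fin (m + 1) → ℝ => ∏ k, (E (w k) * ∫⁻ x, G (w k) x) :=
    measurable_fin_prod_eval fun _ => hEm.mul hGm2
  calc _ ≤ ((m + 1).factorial : ENNReal) * ∫⁻ w : Fin (m + 1) → ℝ,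
        (ENNReal.ofReal ((2 * κ₀) ^ m) * ENNReal.ofReal (exp (β * t))) *
          ∏ k, (E (w k) * ∫⁻ x, G (w k) x) := by
        refine mul_le_mul_right ?_ _
        refine (setLIntegral_mono (hprodm.const_mul _) fun w hw => ?_).trans
          (setLIntegral_le_lintegral _ _)
        rw [Finset.prod_mul_distrib]
        calc _ ≤ _ := hinner w
          _ ≤ (ENNReal.ofReal ((2 * κ₀) ^ m) * ∏ k, ∫⁻ x, G (w k) x) *
              (ENNReal.ofReal (exp (β * t)) * ∏ k, E (w k)) :=
            le_mul_of_one_le_right' (hweight w hw)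
          _ = _ := by ring
    _ = ((m + 1).factorial : ENNReal) *
        ((ENNReal.ofReal ((2 * κ₀) ^ m) * ENNReal.ofReal (exp (β * t))) *
          (∫⁻ w, E w * ∫⁻ x, G w x) ^ (m + 1)) := by
        rw [lintegral_const_mul _ hprodm, lintegral_fin_prod_eq_prod_lintegral _
          (fun _ w => E w * ∫⁻ x, G w x) fun _ => hEm.mul hGm2, Finset.prod_const,
          Finset.card_univ, Fintype.card_fin]
    _ ≤ ((m + 1).factorial : ENNReal) *
        ((ENNReal.ofReal ((2 * κ₀) ^ m) * ENNReal.ofReal (exp (β * t))) *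
          ENNReal.ofReal (4 * C) ^ (m + 1)) := by gcongr
    _ = _ := by
        rw [← ENNReal.ofReal_pow (by positivity), ← ENNReal.ofReal_mul (by positivity),
          ← ENNReal.ofReal_mul (by positivity), ← ENNReal.ofReal_natCast,
          ← ENNReal.ofReal_mul (by positivity)]
        congr 1
        have h1 : β * t = t * D / (2 * C) := by rw [hβdef]; ring
        rw [h1, show 8 * κ₀ * C = (2 * κ₀) * (4 * C) by ring, mul_pow (2 * κ₀), pow_succ (2 * κ₀)]
        field_simp
end

section
/- Let H₀ ∈ (1/2, 1) and H₁ ∈ (0, 1/2), and set 𝔥 = (2H₀ + H₁ − 1)/(2H₀). Then for every c > 0 the series Σ_{n=1}^∞ c^{2n} ((2n)!)^{2H₀−1} / min( Γ(2n𝔥 + (1−H₁)/(2H₀)), Γ(2n𝔥 + 1/(4H₀)) )^{2H₀} converges. -/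
open MeasureTheory in
/-- Restricting Euler's integral to `(A, ∞)` bounds the Gamma function from below. -/
theorem Real.rpow_sub_one_mul_exp_neg_le_Gamma {s A : ℝ} (hs : 1 ≤ s) (hA : 0 < A) :
    A ^ (s - 1) * Real.exp (-A) ≤ Real.Gamma s := by
  have hs0 : 0 < s := by linarith
  have hint := Real.GammaIntegral_convergent hs0
  have hsub : Set.Ioi A ⊆ Set.Ioi (0 : ℝ) := Set.Ioi_subset_Ioi hA.le
  rw [Real.Gamma_eq_integral hs0, ← integral_exp_neg_Ioi A, ← integral_const_mul]
  calc ∫ x in Set.Ioi A, A ^ (s - 1) * Real.exp (-x)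
      ≤ ∫ x in Set.Ioi A, Real.exp (-x) * x ^ (s - 1) := by
        refine setIntegral_mono_on ((integrableOn_exp_neg_Ioi A).const_mul _)
          (hint.mono_set hsub) measurableSet_Ioi fun x hx => ?_
        rw [mul_comm]
        gcongr
        exact (Set.mem_Ioi.mp hx).le
    _ ≤ ∫ x in Set.Ioi 0, Real.exp (-x) * x ^ (s - 1) := by
        refine setIntegral_mono_set hint ?_ hsub.eventuallyLE
        filter_upwards [ae_restrict_mem measurableSet_Ioi] with x hx
        have : 0 < x := hx
        simp only [Pi.zero_apply]
        positivity

/-- A lower bound for a power of the Gamma function along an arithmetic progression. -/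
theorem Real.rpow_mul_exp_neg_le_Gamma_rpow {p h a x : ℝ} (hp : 0 < p) (hp2 : p ≤ 2) (ha : 0 < a)
    (hx : 1 ≤ x) (hs : 1 ≤ x * h) :
    x ^ (x * (p * h) - 2) * Real.exp (-(2 * x)) ≤ Real.Gamma (x * h + a) ^ p := by
  have hx0 : 0 < x := by linarith
  calc x ^ (x * (p * h) - 2) * Real.exp (-(2 * x))
      ≤ x ^ ((x * h + a - 1) * p) * Real.exp (-x * p) := by
        gcongr
        · nlinarith [mul_pos ha hp]
        · nlinarith
    _ = (x ^ (x * h + a - 1) * Real.exp (-x)) ^ p := by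
        rw [Real.mul_rpow (by positivity) (by positivity), ← Real.rpow_mul hx0.le, Real.exp_mul]
    _ ≤ Real.Gamma (x * h + a) ^ p := by
        gcongr
        exact Real.rpow_sub_one_mul_exp_neg_le_Gamma (by linarith) hx0

/-- For H₀ ∈ (1/2,1), H₁ ∈ (0,1/2), 𝔥 = (2H₀+H₁−1)/(2H₀), and every c > 0, the series
Σ_{n≥1} c^{2n} ((2n)!)^{2H₀−1} / min(Γ(2n𝔥+(1−H₁)/(2H₀)), Γ(2n𝔥+1/(4H₀)))^{2H₀}
converges. -/
theorem feynman_kac_series_summable (H₀ H₁ : ℝ) (h0 : 1/2 < H₀) (h0' : H₀ < 1)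
    (h1 : 0 < H₁) (h1' : H₁ < 1/2) (c : ℝ) (hc : 0 < c) :
    Summable (fun n : ℕ =>
      c ^ (2 * (n + 1)) *
        ((Nat.factorial (2 * (n + 1)) : ℝ) ^ (2 * H₀ - 1)) /
        (min (Real.Gamma (((2 * (n + 1) : ℕ) : ℝ) * ((2 * H₀ + H₁ - 1) / (2 * H₀)) +
                (1 - H₁) / (2 * H₀)))
             (Real.Gamma (((2 * (n + 1) : ℕ) : ℝ) * ((2 * H₀ + H₁ - 1) / (2 * H₀)) +
                1 / (4 * H₀)))) ^ (2 * H₀)) := by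
  set h : ℝ := (2 * H₀ + H₁ - 1) / (2 * H₀) with hh
  have hh0 : 0 < h := div_pos (by linarith) (by linarith)
  have hph : 2 * H₀ * h = 2 * H₀ + H₁ - 1 := by rw [hh]; field_simp
  have ha : 0 < (1 - H₁) / (2 * H₀) := div_pos (by linarith) (by linarith)
  have hb : 0 < 1 / (4 * H₀) := div_pos one_pos (by linarith)
  have hinj : Function.Injective fun n : ℕ => 2 * (n + 1) := fun a b hab => by
    simp only at hab; omega
  have hg : Summable fun m : ℕ => (m : ℝ) ^ 2 * (1 / 2 : ℝ) ^ m :=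
    summable_pow_mul_geometric_of_norm_lt_one 2 (by norm_num)
  have hcast : Filter.Tendsto (fun m : ℕ => (m : ℝ)) Filter.atTop Filter.atTop :=
    tendsto_natCast_atTop_atTop
  have hlim : Filter.Tendsto (fun m : ℕ => c * Real.exp 2 * (m : ℝ) ^ (-H₁)) Filter.atTop
      (nhds 0) := by
    simpa using ((tendsto_rpow_neg_atTop h1).comp hcast).const_mul (c * Real.exp 2)
  have hev : ∀ᶠ m : ℕ in Filter.atTop,
      ‖c ^ m * ((Nat.factorial m : ℝ) ^ (2 * H₀ - 1)) /
        (min (Real.Gamma ((m : ℝ) * h + (1 - H₁) / (2 * H₀)))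
          (Real.Gamma ((m : ℝ) * h + 1 / (4 * H₀)))) ^ (2 * H₀)‖
        ≤ (m : ℝ) ^ 2 * (1 / 2 : ℝ) ^ m := by
    filter_upwards [hlim.eventually_le_const (show (0 : ℝ) < 1 / 2 by norm_num),
      hcast.eventually_ge_atTop 1, hcast.eventually_ge_atTop (1 / h)] with m hm hm1 hmh
    have hm0 : (0 : ℝ) < m := by linarith
    have hmh' : 1 ≤ (m : ℝ) * h := (div_le_iff₀ hh0).mp hmh
    have hD : (m : ℝ) ^ ((m : ℝ) * (2 * H₀ * h) - 2) * Real.exp (-(2 * m)) ≤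
        (min (Real.Gamma ((m : ℝ) * h + (1 - H₁) / (2 * H₀)))
          (Real.Gamma ((m : ℝ) * h + 1 / (4 * H₀)))) ^ (2 * H₀) := by
      rcases min_choice (Real.Gamma ((m : ℝ) * h + (1 - H₁) / (2 * H₀)))
        (Real.Gamma ((m : ℝ) * h + 1 / (4 * H₀))) with e | e <;> rw [e]
      · exact Real.rpow_mul_exp_neg_le_Gamma_rpow (by linarith) (by linarith) ha hm1 hmh'
      · exact Real.rpow_mul_exp_neg_le_Gamma_rpow (by linarith) (by linarith) hb hm1 hmh'
    have hD0 : 0 < (m : ℝ) ^ ((m : ℝ) * (2 * H₀ * h) - 2) * Real.exp (-(2 * m)) := by positivity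
    rw [Real.norm_of_nonneg (div_nonneg (by positivity) (hD0.le.trans hD))]
    have hfac : (Nat.factorial m : ℝ) ^ (2 * H₀ - 1) ≤ (m : ℝ) ^ ((m : ℝ) * (2 * H₀ - 1)) := by
      rw [Real.rpow_mul hm0.le, Real.rpow_natCast]
      gcongr
      · linarith
      · exact_mod_cast Nat.factorial_le_pow m
    calc _ ≤ c ^ m * (m : ℝ) ^ ((m : ℝ) * (2 * H₀ - 1)) /
          ((m : ℝ) ^ ((m : ℝ) * (2 * H₀ * h) - 2) * Real.exp (-(2 * m))) := by gcongr
      _ = (m : ℝ) ^ 2 * (c * Real.exp 2 * (m : ℝ) ^ (-H₁)) ^ m := by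
        rw [div_eq_iff hD0.ne', hph, mul_pow, mul_pow, ← Real.exp_nat_mul,
          ← Real.rpow_mul_natCast hm0.le, ← Real.rpow_natCast (m : ℝ) 2]
        have e1 : Real.exp (m * 2) * Real.exp (-(2 * m)) = 1 := by
          rw [← Real.exp_add, ← Real.exp_zero]; congr 1; ring
        have e2 : (m : ℝ) ^ ((m : ℝ) * (2 * H₀ - 1)) = (m : ℝ) ^ ((2 : ℕ) : ℝ) *
            (m : ℝ) ^ (-H₁ * m) * (m : ℝ) ^ ((m : ℝ) * (2 * H₀ + H₁ - 1) - 2) := by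
          rw [← Real.rpow_add hm0, ← Real.rpow_add hm0]; congr 1; push_cast; ring
        rw [e2]
        linear_combination (-(c ^ m * ((m : ℝ) ^ ((2 : ℕ) : ℝ) *
            (m : ℝ) ^ (-H₁ * m) * (m : ℝ) ^ ((m : ℝ) * (2 * H₀ + H₁ - 1) - 2)))) * e1
      _ ≤ (m : ℝ) ^ 2 * (1 / 2 : ℝ) ^ m := by gcongr
  refine Summable.of_norm_bounded_eventually_nat (hg.comp_injective hinj) ?_
  exact (Filter.tendsto_atTop_mono (fun n => show n ≤ 2 * (n + 1) by omega) Filter.tendsto_id :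
    Filter.Tendsto (fun n : ℕ => 2 * (n + 1)) Filter.atTop Filter.atTop).eventually hev
end

section
/- Suppose φ : ℝ → [0,∞) is Lebesgue measurable, bounded on [−δ, δ] for some δ > 0, and satisfies ∫_{{|x| ≥ δ}} φ(x)/x² dx < ∞. Then sup_{a ∈ (0,1)} ∫_ℝ G(a, x) (1 + φ(x)) dx < ∞. -/
open MeasureTheory Real

theorem sq_mul_gaussianPDFReal_zero_le_sqrt (v : NNReal) (x : ℝ) :
    x ^ 2 * ProbabilityTheory.gaussianPDFReal 0 v x ≤ √v := by
  rcases eq_or_ne v 0 with rfl | hv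
  · simp
  have hv : (0 : ℝ) < v := by exact_mod_cast hv.bot_lt
  have hexp : x ^ 2 * exp (-x ^ 2 / (2 * v)) ≤ 2 * v := by
    have h : x ^ 2 / (2 * v) ≤ exp (x ^ 2 / (2 * v)) := by
      linarith [add_one_le_exp (x ^ 2 / (2 * v))]
    rw [neg_div, exp_neg, ← div_eq_mul_inv, div_le_iff₀ (exp_pos _)]
    rwa [div_le_iff₀' (by positivity)] at h
  have hsqrt : 2 * (v : ℝ) ≤ √v * √(2 * π * v) := by
    rw [← sqrt_mul hv.le]
    apply le_sqrt_of_sq_le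
    nlinarith [pi_gt_three, mul_pos hv hv]
  rw [ProbabilityTheory.gaussianPDFReal, sub_zero, mul_left_comm, inv_mul_le_iff₀ (by positivity),
    mul_comm (√(2 * π * v))]
  exact hexp.trans hsqrt

theorem rpow_mul_exp_eq_gaussianPDFReal {a : ℝ} (ha : 0 < a) (x : ℝ) :
    (2 * π * a) ^ (-(1 : ℝ) / 2) * exp (-x ^ 2 / (2 * a)) =
      ProbabilityTheory.gaussianPDFReal 0 a.toNNReal x := by
  rw [ProbabilityTheory.gaussianPDFReal, sub_zero, coe_toNNReal a ha.le, neg_div,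
    rpow_neg (by positivity), ← sqrt_eq_rpow]

/-- If φ ≥ 0 is measurable, bounded on [−δ,δ] for some δ > 0, and ∫_{|x|≥δ} φ(x)/x² dx < ∞,
then sup_{a ∈ (0,1)} ∫_ℝ G(a,x)(1+φ(x)) dx < ∞, where G(a,x) = (2πa)^{−1/2} e^{−x²/(2a)}. -/
theorem heat_kernel_sup_bound (φ : ℝ → ℝ) (hφm : Measurable φ) (hφnn : ∀ x, 0 ≤ φ x)
    (δ : ℝ) (hδ : 0 < δ) (B : ℝ) (hB : ∀ x ∈ Set.Icc (-δ) δ, φ x ≤ B)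
    (hφint : MeasureTheory.IntegrableOn (fun x => φ x / x ^ 2) {x : ℝ | δ ≤ |x|}) :
    ∃ M : ℝ, ∀ a ∈ Set.Ioo (0 : ℝ) 1,
      (∫⁻ x : ℝ, ENNReal.ofReal
          ((2 * Real.pi * a) ^ (-(1 : ℝ) / 2) * Real.exp (-x ^ 2 / (2 * a)) * (1 + φ x)))
        ≤ ENNReal.ofReal M := by
  set S : Set ℝ := {x : ℝ | δ ≤ |x|}
  have hS : MeasurableSet S := measurableSet_le measurable_const measurable_id.abs
  have hB0 : 0 ≤ B := (hφnn 0).trans (hB 0 ⟨by linarith, hδ.le⟩)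
  have hψ : ∀ x, 0 ≤ φ x / x ^ 2 := fun x => div_nonneg (hφnn x) (sq_nonneg x)
  refine ⟨(1 + B) + ∫ x in S, φ x / x ^ 2, fun a ⟨ha0, ha1⟩ => ?_⟩
  simp_rw [rpow_mul_exp_eq_gaussianPDFReal ha0]
  set g := ProbabilityTheory.gaussianPDFReal 0 a.toNNReal
  have hg : ∀ x, 0 ≤ g x := ProbabilityTheory.gaussianPDFReal_nonneg 0 _
  have hgm : Measurable g := ProbabilityTheory.measurable_gaussianPDFReal 0 _
  have hbound : ∀ x, ENNReal.ofReal (g x * (1 + φ x)) ≤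
      ENNReal.ofReal (1 + B) * ENNReal.ofReal (g x) +
        S.indicator (fun x => ENNReal.ofReal (φ x / x ^ 2)) x := by
    intro x
    rw [← ENNReal.ofReal_mul (by positivity)]
    by_cases hx : x ∈ S
    · rw [Set.indicator_of_mem hx,
        ← ENNReal.ofReal_add (mul_nonneg (by positivity) (hg x)) (hψ x)]
      apply ENNReal.ofReal_le_ofReal
      have hx0 : x ≠ 0 := abs_pos.mp (hδ.trans_le hx)
      have hle : x ^ 2 * g x ≤ 1 := by
        refine (sq_mul_gaussianPDFReal_zero_le_sqrt _ x).trans ?_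
        rw [coe_toNNReal a ha0.le]
        exact sqrt_le_one.mpr ha1.le
      have hmul : g x * φ x ≤ φ x / x ^ 2 := by
        rw [le_div_iff₀ (by positivity)]
        nlinarith [hφnn x]
      nlinarith [mul_nonneg hB0 (hg x)]
    · rw [Set.indicator_of_notMem hx, add_zero]
      apply ENNReal.ofReal_le_ofReal
      have hφx := hB x (abs_le.mp (not_le.mp hx).le)
      nlinarith [hg x]
  calc ∫⁻ x, ENNReal.ofReal (g x * (1 + φ x))
      ≤ ∫⁻ x, (ENNReal.ofReal (1 + B) * ENNReal.ofReal (g x) +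
          S.indicator (fun x => ENNReal.ofReal (φ x / x ^ 2)) x) := lintegral_mono hbound
    _ = ENNReal.ofReal (1 + B) + ENNReal.ofReal (∫ x in S, φ x / x ^ 2) := by
      rw [lintegral_add_left (by fun_prop), lintegral_const_mul _ (by fun_prop),
        ProbabilityTheory.lintegral_gaussianPDFReal_eq_one 0 (by simpa using ha0), mul_one,
        lintegral_indicator hS,
        ofReal_integral_eq_lintegral_ofReal hφint (Filter.Eventually.of_forall hψ)]
    _ = ENNReal.ofReal ((1 + B) + ∫ x in S, φ x / x ^ 2) :=
      (ENNReal.ofReal_add (by positivity) (integral_nonneg hψ)).symm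
end

section
/- For every T > 0 there exists a constant C > 0, depending only on T, φ and γ₀, such that for all real numbers 0 < s < t ≤ T ≤ R, ∫_{[0,s]²} γ₀(r − v) ( ∫_ℝ φ(ξ) ℓ_R(ξ) ( e^{−(t−r)ξ²/2} − e^{−(s−r)ξ²/2} ) ( e^{−(t−v)ξ²/2} − e^{−(s−v)ξ²/2} ) dξ ) dr dv ≤ C (t − s). (This is the deterministic estimate giving the tightness bound for the first Wiener chaos of the increments A_t(R) − A_s(R).) -/
open MeasureTheory Real

/-- The total mass of `r ↦ c * exp (-(s - r) * c)` on `[0, s]` is at most one. -/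
lemma lintegral_mul_exp_le_one (s c : ℝ) (hs : 0 ≤ s) (hc : 0 ≤ c) :
    ∫⁻ r in Set.Icc (0:ℝ) s, ENNReal.ofReal (c * Real.exp (-(s - r) * c)) ≤ 1 := by
  have hint : ∫ r in (0:ℝ)..s, c * Real.exp (-(s - r) * c) =
      Real.exp (-(s - s) * c) - Real.exp (-(s - 0) * c) := by
    refine intervalIntegral.integral_eq_sub_of_hasDerivAt (f := fun r => Real.exp (-(s - r) * c))
      (fun r _ => ?_) (Continuous.intervalIntegrable (by fun_prop) _ _)
    have h : HasDerivAt (fun r : ℝ => -(s - r) * c) c r := by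
      simpa using (((hasDerivAt_id r).const_sub s).neg.mul_const c)
    simpa [mul_comm] using h.exp
  rw [← ofReal_integral_eq_lintegral_ofReal
    ((Continuous.continuousOn (by fun_prop)).integrableOn_compact isCompact_Icc)
    (Filter.Eventually.of_forall fun r => by positivity),
    integral_Icc_eq_integral_Ioc, ← intervalIntegral.integral_of_le hs, hint]
  refine ENNReal.ofReal_le_one.2 ?_
  simp only [sub_self, neg_zero, zero_mul, Real.exp_zero]
  linarith [Real.exp_pos (-(s - 0) * c)]

/-- The product of two heat-kernel increments is bounded uniformly in the second time. -/
lemma exp_sub_mul_exp_sub_le (s t r v x : ℝ) (hst : s ≤ t) (hv : v ≤ s) :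
    (Real.exp (-(t - r) * x ^ 2 / 2) - Real.exp (-(s - r) * x ^ 2 / 2)) *
      (Real.exp (-(t - v) * x ^ 2 / 2) - Real.exp (-(s - v) * x ^ 2 / 2)) ≤
    (t - s) * (x ^ 2 / 2 * Real.exp (-(s - r) * (x ^ 2 / 2))) := by
  have hx := sq_nonneg x
  set d := Real.exp (-(t - s) * x ^ 2 / 2) with hd
  have h1 : ∀ u, Real.exp (-(t - u) * x ^ 2 / 2) = Real.exp (-(s - u) * x ^ 2 / 2) * d := by
    intro u
    rw [hd, ← Real.exp_add]
    ring_nf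
  have hd0 : 0 ≤ d := (Real.exp_pos _).le
  have hd1 : d ≤ 1 := Real.exp_le_one_iff.2 (by nlinarith)
  have hd2 : 1 - d ≤ (t - s) * (x ^ 2 / 2) := by
    have := Real.add_one_le_exp (-(t - s) * x ^ 2 / 2)
    linarith
  have hv1 : Real.exp (-(s - v) * x ^ 2 / 2) ≤ 1 := Real.exp_le_one_iff.2 (by nlinarith)
  have hr0 := Real.exp_pos (-(s - r) * x ^ 2 / 2)
  have hv0 := Real.exp_pos (-(s - v) * x ^ 2 / 2)
  rw [h1 r, h1 v, show -(s - r) * (x ^ 2 / 2) = -(s - r) * x ^ 2 / 2 by ring]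
  set a := Real.exp (-(s - r) * x ^ 2 / 2)
  set b := Real.exp (-(s - v) * x ^ 2 / 2)
  calc (a * d - a) * (b * d - b) = a * ((1 - d) * ((1 - d) * b)) := by ring
    _ ≤ a * (((t - s) * (x ^ 2 / 2)) * 1) := by
        gcongr
        nlinarith
    _ = _ := by ring

/-- The Fejér kernel is dominated by a Cauchy kernel of the same scale. -/
lemma fejer_le_cauchy (R x : ℝ) (hR : 0 < R) :
    Real.sin (R * x) ^ 2 / (Real.pi * R * x ^ 2) ≤
      2 / Real.pi * (R * (1 + (R * x) ^ 2)⁻¹) := by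
  rcases eq_or_ne x 0 with rfl | hx
  · simp only [mul_zero, Real.sin_zero]
    norm_num
    positivity
  have h1 : Real.sin (R * x) ^ 2 ≤ 1 := Real.sin_sq_le_one _
  have h2 : Real.sin (R * x) ^ 2 ≤ (R * x) ^ 2 := sq_le_sq.2 Real.abs_sin_le_abs
  have hx2 : 0 < x ^ 2 := by positivity
  rw [show 2 / Real.pi * (R * (1 + (R * x) ^ 2)⁻¹) = 2 * R / (Real.pi * (1 + (R * x) ^ 2)) by
    field_simp, div_le_div_iff₀ (by positivity) (by positivity)]
  have h3 : Real.sin (R * x) ^ 2 * (1 + (R * x) ^ 2) ≤ 2 * (R * x) ^ 2 := by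
    nlinarith [sq_nonneg (R * x)]
  calc Real.sin (R * x) ^ 2 * (Real.pi * (1 + (R * x) ^ 2))
      = Real.pi * (Real.sin (R * x) ^ 2 * (1 + (R * x) ^ 2)) := by ring
    _ ≤ Real.pi * (2 * (R * x) ^ 2) := by gcongr
    _ = _ := by ring

/-- Integrals of `φ` against Fejér kernels of scale at least `T` are uniformly bounded. -/
lemma exists_lintegral_fejer_le (φ : ℝ → ℝ) (hφnn : ∀ x, 0 ≤ φ x)
    (hφcont : ContinuousAt φ 0) (hφ0 : φ 0 = 0)
    (hφint : ∀ δ : ℝ, 0 < δ → IntegrableOn (fun ξ => φ ξ / ξ ^ 2) {ξ : ℝ | δ ≤ |ξ|})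
    (T : ℝ) (hT : 0 < T) :
    ∃ K : ℝ, 0 ≤ K ∧ ∀ R, T ≤ R →
      ∫⁻ ξ : ℝ, ENNReal.ofReal (φ ξ * (Real.sin (R * ξ) ^ 2 / (Real.pi * R * ξ ^ 2))) ≤
        ENNReal.ofReal K := by
  obtain ⟨δ, hδ, hφδ⟩ := Metric.continuousAt_iff.1 hφcont 1 one_pos
  have hS : MeasurableSet {ξ : ℝ | δ ≤ |ξ|} :=
    measurableSet_le measurable_const (by fun_prop)
  set h : ℝ → ℝ := {ξ : ℝ | δ ≤ |ξ|}.indicator (fun ξ => φ ξ / ξ ^ 2)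
  have hhint : Integrable h := (hφint δ hδ).integrable_indicator hS
  have hhnn : ∀ x, 0 ≤ h x := fun x =>
    Set.indicator_nonneg (fun ξ _ => div_nonneg (hφnn ξ) (sq_nonneg ξ)) x
  refine ⟨2 + (Real.pi * T)⁻¹ * ∫ x, h x, ?_, fun R hR => ?_⟩
  · have : 0 ≤ ∫ x, h x := integral_nonneg fun x => hhnn x
    positivity
  have hR0 : 0 < R := hT.trans_le hR
  have hcint : Integrable fun x : ℝ => 2 / Real.pi * (R * (1 + (R * x) ^ 2)⁻¹) :=
    ((integrable_inv_one_add_sq.comp_mul_left' hR0.ne').const_mul R).const_mul _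
  have hcauchy : ∫ x : ℝ, 2 / Real.pi * (R * (1 + (R * x) ^ 2)⁻¹) = 2 := by
    rw [integral_const_mul, integral_const_mul,
      Measure.integral_comp_mul_left (fun y : ℝ => (1 + y ^ 2)⁻¹) R,
      integral_univ_inv_one_add_sq, abs_of_pos (inv_pos.2 hR0), smul_eq_mul]
    field_simp
  have hpt : ∀ x, φ x * (Real.sin (R * x) ^ 2 / (Real.pi * R * x ^ 2)) ≤
      2 / Real.pi * (R * (1 + (R * x) ^ 2)⁻¹) + (Real.pi * T)⁻¹ * h x := by
    intro x
    by_cases hx : δ ≤ |x|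
    · have hx0 : 0 < x ^ 2 := by
        have : x ≠ 0 := abs_pos.1 (hδ.trans_le hx)
        positivity
      have hhx : h x = φ x / x ^ 2 := Set.indicator_of_mem (s := {ξ : ℝ | δ ≤ |ξ|}) hx _
      have hb : φ x * (Real.sin (R * x) ^ 2 / (Real.pi * R * x ^ 2)) ≤
          φ x * (1 / (Real.pi * T * x ^ 2)) := by
        have := hφnn x
        gcongr
        exact Real.sin_sq_le_one _
      have he : φ x * (1 / (Real.pi * T * x ^ 2)) = (Real.pi * T)⁻¹ * h x := by
        rw [hhx]
        field_simp
      have : 0 ≤ 2 / Real.pi * (R * (1 + (R * x) ^ 2)⁻¹) := by positivity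
      linarith
    · have hφ1 : φ x ≤ 1 := by
        have := hφδ (x := x) (by simpa [Real.dist_eq] using hx)
        rw [hφ0, Real.dist_eq, sub_zero] at this
        exact (le_abs_self _).trans this.le
      have h0 : 0 ≤ Real.sin (R * x) ^ 2 / (Real.pi * R * x ^ 2) := by positivity
      have h1 := fejer_le_cauchy R x hR0
      have h2 : 0 ≤ (Real.pi * T)⁻¹ * h x := mul_nonneg (by positivity) (hhnn x)
      nlinarith
  calc _ ≤ ∫⁻ x, ENNReal.ofReal
        (2 / Real.pi * (R * (1 + (R * x) ^ 2)⁻¹) + (Real.pi * T)⁻¹ * h x) :=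
        lintegral_mono fun x => ENNReal.ofReal_le_ofReal (hpt x)
    _ = ENNReal.ofReal (2 + (Real.pi * T)⁻¹ * ∫ x, h x) := by
        rw [← ofReal_integral_eq_lintegral_ofReal
          (f := fun x => 2 / Real.pi * (R * (1 + (R * x) ^ 2)⁻¹) + (Real.pi * T)⁻¹ * h x)
          (hcint.add (hhint.const_mul _)) (Filter.Eventually.of_forall fun x =>
            add_nonneg (by positivity) (mul_nonneg (by positivity) (hhnn x))),
          integral_add hcint (hhint.const_mul _), hcauchy, integral_const_mul]

/-- The integral of a translated reflection over `[0, s]` is controlled on `[-T, T]`. -/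
lemma setLIntegral_comp_sub_le (f : ℝ → ENNReal) (s T r : ℝ) (hs : s ≤ T)
    (hr : r ∈ Set.Icc 0 s) :
    ∫⁻ v in Set.Icc (0:ℝ) s, f (r - v) ≤ ∫⁻ x in Set.Icc (-T) T, f x := by
  rw [← lintegral_indicator measurableSet_Icc, ← lintegral_indicator measurableSet_Icc,
    ← lintegral_sub_left_eq_self ((Set.Icc (-T) T).indicator f) r]
  refine lintegral_mono fun v => ?_
  by_cases hv : v ∈ Set.Icc 0 s
  swap
  · simp [Set.indicator_of_notMem hv]
  rw [Set.indicator_of_mem hv, Set.indicator_of_mem]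
  exact ⟨by linarith [hr.1, hv.2], by linarith [hr.2, hv.1]⟩

/-- Tightness bound for the first Wiener chaos of increments: for every T > 0 there is a
constant C > 0 such that for all 0 < s < t ≤ T ≤ R,
∫_{[0,s]²} γ₀(r−v) ∫_ℝ φ(ξ) ℓ_R(ξ) (e^{−(t−r)ξ²/2} − e^{−(s−r)ξ²/2})
  (e^{−(t−v)ξ²/2} − e^{−(s−v)ξ²/2}) dξ dr dv ≤ C (t − s),
where ℓ_R(ξ) = sin²(Rξ)/(π R ξ²). -/
theorem first_chaos_increment_bound (φ : ℝ → ℝ) (hφm : Measurable φ) (hφnn : ∀ x, 0 ≤ φ x)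
    (hφcont : ContinuousAt φ 0) (hφ0 : φ 0 = 0)
    (hφint : ∀ δ : ℝ, 0 < δ →
      MeasureTheory.IntegrableOn (fun ξ => φ ξ / ξ ^ 2) {ξ : ℝ | δ ≤ |ξ|})
    (γ₀ : ℝ → ℝ) (hγm : Measurable γ₀) (hγnn : ∀ x, 0 ≤ γ₀ x)
    (hγloc : MeasureTheory.LocallyIntegrable γ₀) :
    ∀ T : ℝ, 0 < T → ∃ C : ℝ, 0 < C ∧ ∀ s t R : ℝ, 0 < s → s < t → t ≤ T → T ≤ R →
      (∫⁻ r in Set.Icc (0:ℝ) s, ∫⁻ v in Set.Icc (0:ℝ) s,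
          ENNReal.ofReal (γ₀ (r - v)) *
            ∫⁻ ξ : ℝ, ENNReal.ofReal
              (φ ξ * (Real.sin (R * ξ) ^ 2 / (Real.pi * R * ξ ^ 2)) *
                ((Real.exp (-(t - r) * ξ ^ 2 / 2) - Real.exp (-(s - r) * ξ ^ 2 / 2)) *
                 (Real.exp (-(t - v) * ξ ^ 2 / 2) - Real.exp (-(s - v) * ξ ^ 2 / 2)))))
        ≤ ENNReal.ofReal (C * (t - s)) := by
  intro T hT
  obtain ⟨K, hK0, hK⟩ := exists_lintegral_fejer_le φ hφnn hφcont hφ0 hφint T hT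
  set Γ : ENNReal := ∫⁻ x in Set.Icc (-T) T, ENNReal.ofReal (γ₀ x) with hΓ
  have hΓtop : Γ ≠ ⊤ := by
    have hint : IntegrableOn γ₀ (Set.Icc (-T) T) := hγloc.integrableOn_isCompact isCompact_Icc
    rw [hΓ, ← ofReal_integral_eq_lintegral_ofReal hint (Filter.Eventually.of_forall hγnn)]
    exact ENNReal.ofReal_ne_top
  refine ⟨Γ.toReal * K + 1, by positivity, fun s t R hs hst htT hTR => ?_⟩
  have hR0 : 0 < R := hT.trans_le hTR
  have hts : 0 ≤ t - s := sub_nonneg.2 hst.le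
  set w : ℝ → ℝ := fun ξ => φ ξ * (Real.sin (R * ξ) ^ 2 / (Real.pi * R * ξ ^ 2))
  have hwnn : ∀ ξ, 0 ≤ w ξ := fun ξ => mul_nonneg (hφnn ξ) (by positivity)
  have hwm : Measurable w := by fun_prop
  set G : ℝ → ENNReal := fun r => ∫⁻ ξ : ℝ, ENNReal.ofReal
    (w ξ * ((t - s) * (ξ ^ 2 / 2 * Real.exp (-(s - r) * (ξ ^ 2 / 2))))) with hG
  have hGint : ∫⁻ r in Set.Icc (0:ℝ) s, G r ≤ ENNReal.ofReal ((t - s) * K) := by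
    rw [hG, lintegral_lintegral_swap (by fun_prop)]
    calc _ ≤ ∫⁻ ξ, ENNReal.ofReal (t - s) * ENNReal.ofReal (w ξ) := by
          refine lintegral_mono fun ξ => ?_
          have hsplit : ∀ r : ℝ, ENNReal.ofReal
              (w ξ * ((t - s) * (ξ ^ 2 / 2 * Real.exp (-(s - r) * (ξ ^ 2 / 2))))) =
              ENNReal.ofReal (t - s) * ENNReal.ofReal (w ξ) *
                ENNReal.ofReal (ξ ^ 2 / 2 * Real.exp (-(s - r) * (ξ ^ 2 / 2))) := fun r => by
            rw [← ENNReal.ofReal_mul hts, ← ENNReal.ofReal_mul (mul_nonneg hts (hwnn ξ))]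
            ring_nf
          simp_rw [hsplit]
          rw [lintegral_const_mul _ (by fun_prop)]
          exact mul_le_of_le_one_right' (lintegral_mul_exp_le_one s _ hs.le (by positivity))
      _ = ENNReal.ofReal (t - s) * ∫⁻ ξ, ENNReal.ofReal (w ξ) :=
          lintegral_const_mul _ (by fun_prop)
      _ ≤ ENNReal.ofReal ((t - s) * K) := by
          rw [ENNReal.ofReal_mul hts]
          exact mul_le_mul_right (hK R hTR) _
  calc _ ≤ ∫⁻ r in Set.Icc (0:ℝ) s, Γ * G r := by
        refine setLIntegral_mono' measurableSet_Icc fun r hr => ?_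
        calc _ ≤ ∫⁻ v in Set.Icc (0:ℝ) s, ENNReal.ofReal (γ₀ (r - v)) * G r := by
              refine setLIntegral_mono' measurableSet_Icc fun v hv => ?_
              refine mul_le_mul_right (lintegral_mono fun ξ => ENNReal.ofReal_le_ofReal ?_) _
              exact mul_le_mul_of_nonneg_left
                (exp_sub_mul_exp_sub_le s t r v ξ hst.le hv.2) (hwnn ξ)
          _ = (∫⁻ v in Set.Icc (0:ℝ) s, ENNReal.ofReal (γ₀ (r - v))) * G r :=
              lintegral_mul_const _ (by fun_prop)
          _ ≤ Γ * G r := by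
              gcongr
              exact setLIntegral_comp_sub_le (fun x => ENNReal.ofReal (γ₀ x)) s T r
                (hst.le.trans htT) hr
    _ = Γ * ∫⁻ r in Set.Icc (0:ℝ) s, G r := lintegral_const_mul' _ _ hΓtop
    _ ≤ ENNReal.ofReal Γ.toReal * ENNReal.ofReal ((t - s) * K) := by
        rw [ENNReal.ofReal_toReal hΓtop]
        gcongr
    _ ≤ ENNReal.ofReal ((Γ.toReal * K + 1) * (t - s)) := by
        rw [← ENNReal.ofReal_mul ENNReal.toReal_nonneg]
        refine ENNReal.ofReal_le_ofReal ?_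
        linarith
end
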